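/- Let b > 0 and let h : (0, b) → ℂ be measurable with ∫₀^b |h(t)|² dt/t < ∞. Then the function F(z) = (2z/√π) ∫₀^b e^{−z² t} h(t) dt is an entire function of z ∈ ℂ, and its restriction to Δ belongs to the Bergman space A²(Δ): ∫_Δ |F(z)|² dA(z) < ∞. (These functions constitute the orthogonal complement X₀ of the range of Φ̃_τ in A²(Δ) when b = 1/(4τ); in particular every element of X₀ extends to an entire function.) -/

import Mathlib

open MeasureTheory Set

noncomputable section

/-- The open sector `Δ = {z : |arg z| < π/4}`. -/
def SectorDelta : Set ℂ := {z : ℂ | 0 < z.re ∧ |z.im| < z.re}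

/-- The reflected sector `π − Δ`. -/
def SectorPiDelta : Set ℂ := (fun z => (Real.pi : ℂ) - z) '' SectorDelta

/-- The open square `D = Δ ∩ (π − Δ)` with vertices `0, π/2 − iπ/2, π, π/2 + iπ/2`. -/
def SquareD : Set ℂ := SectorDelta ∩ SectorPiDelta

/-- Membership in the Bergman space `A²(Ω)`. -/
def MemA2 (Ω : Set ℂ) (f : ℂ → ℂ) : Prop :=
  DifferentiableOn ℂ f Ω ∧ ∫⁻ z in Ω, ENNReal.ofReal (‖f z‖ ^ 2) < ⊤

/-- Membership in the weighted Bergman space `A²(Ω, w)`. -/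
def MemA2W (Ω : Set ℂ) (w : ℂ → ℝ) (f : ℂ → ℂ) : Prop :=
  DifferentiableOn ℂ f Ω ∧ ∫⁻ z in Ω, ENNReal.ofReal (‖f z‖ ^ 2 * w z) < ⊤

/-- `log⁺ t = max (log t) 0`. -/
def logPlus (t : ℝ) : ℝ := Real.log (max t 1)

/-- Starting vertices of the four sides of `∂D`, counterclockwise. -/
def sideStart : Fin 4 → ℂ
  | 0 => 0
  | 1 => ((Real.pi / 2 : ℝ) : ℂ) * (1 - Complex.I)
  | 2 => ((Real.pi : ℝ) : ℂ)
  | 3 => ((Real.pi / 2 : ℝ) : ℂ) * (1 + Complex.I)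

/-- Direction vectors of the four sides of `∂D`, counterclockwise. -/
def sideDir : Fin 4 → ℂ
  | 0 => ((Real.pi / 2 : ℝ) : ℂ) * (1 - Complex.I)
  | 1 => ((Real.pi / 2 : ℝ) : ℂ) * (1 + Complex.I)
  | 2 => ((Real.pi / 2 : ℝ) : ℂ) * (Complex.I - 1)
  | 3 => -(((Real.pi / 2 : ℝ) : ℂ) * (1 + Complex.I))

/-- Parametrization of the `k`-th side of `∂D`. -/
def sidePath (k : Fin 4) (t : ℝ) : ℂ := sideStart k + (t : ℂ) * sideDir k

/-- `g` is arclength-integrable on `∂D` (each side has constant speed). -/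
def BoundaryIntegrable (g : ℂ → ℂ) : Prop :=
  ∀ k : Fin 4, IntervalIntegrable (fun t => ‖g (sidePath k t)‖) volume 0 1

/-- `∫_{∂D} |g| log⁺|g| |du| < ∞` (each side has constant speed). -/
def BoundaryLlogL (g : ℂ → ℂ) : Prop :=
  ∀ k : Fin 4, IntervalIntegrable
    (fun t => ‖g (sidePath k t)‖ * logPlus ‖g (sidePath k t)‖) volume 0 1

/-- The Cauchy integral `(1/(2πi)) ∮_{∂D} g(u)/(u − z) du`, `∂D` counterclockwise. -/
def cauchyD (g : ℂ → ℂ) (z : ℂ) : ℂ :=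
  (2 * (Real.pi : ℂ) * Complex.I)⁻¹ *
    ∑ k : Fin 4, ∫ t in (0:ℝ)..1, g (sidePath k t) * sideDir k / (sidePath k t - z)

/-- The Cauchy transform `(𝒞g)(z) = (1/(iπ)) ∫_ℝ g(t)/(t − z) dt` on the upper half-plane. -/
def cauchyTransform (g : ℝ → ℂ) (z : ℂ) : ℂ :=
  (Complex.I * (Real.pi : ℂ))⁻¹ * ∫ t : ℝ, g t / ((t : ℂ) - z)


/-- The Laplace-type transform `F(z) = (2z/√π) ∫₀^b e^{−z²t} h(t) dt`. -/
def laplaceComplement (b : ℝ) (h : ℝ → ℂ) (z : ℂ) : ℂ :=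
  2 * z / ((Real.sqrt Real.pi : ℝ) : ℂ) *
    ∫ t in Ioo (0:ℝ) b, Complex.exp (-z ^ 2 * (t : ℂ)) * h t


section helpers
open FourierTransform SchwartzMap

/-- Plancherel for `L¹ ∩ L²`. -/
lemma plancherel_aux (f : ℝ → ℂ) (h1 : Integrable f) (h2 : MemLp f 2) :
    ∫⁻ ξ : ℝ, ENNReal.ofReal (‖𝓕 f ξ‖ ^ 2) = ∫⁻ t : ℝ, ENNReal.ofReal (‖f t‖ ^ 2) := by
  have hcont : Continuous (𝓕 f) :=
    VectorFourier.fourierIntegral_continuous Real.continuous_fourierChar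
      (by exact continuous_inner) h1
  have hae : ∀ᵐ ξ : ℝ, (𝓕 (h2.toLp f) : Lp ℂ 2 (volume : Measure ℝ)) ξ = 𝓕 f ξ := by
    apply ae_eq_of_integral_contDiff_smul_eq
    · exact (Lp.memLp _).locallyIntegrable (by norm_num)
    · exact hcont.locallyIntegrable
    · intro g g_smooth g_cpt
      have hg₁ : HasCompactSupport (Complex.ofRealCLM ∘ g) := g_cpt.comp_left rfl
      have hg₂ : ContDiff ℝ ((⊤ : ℕ∞) : WithTop ℕ∞) (Complex.ofRealCLM ∘ g) := by fun_prop
      set φ : 𝓢(ℝ, ℂ) := hg₁.toSchwartzMap hg₂ with hφ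
      have hφx : ∀ x, φ x = (g x : ℂ) := fun x => by simp [hφ]
      have e1 := congrArg (fun T => T φ) (Lp.fourier_toTemperedDistribution_eq (h2.toLp f))
      simp only [TemperedDistribution.fourier_apply, Lp.toTemperedDistribution_apply] at e1
      have e2 : ∫ x, (𝓕 φ) x • (h2.toLp f) x = ∫ x, (𝓕 φ) x • f x := by
        apply integral_congr_ae
        filter_upwards [h2.coeFn_toLp] with x hx
        rw [hx]
      have e3 : ∫ x, (𝓕 φ) x • f x = ∫ x, φ x • 𝓕 f x := by
        rw [SchwartzMap.fourier_coe]
        have := VectorFourier.integral_fourierIntegral_smul_eq_flip (μ := volume) (ν := volume)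
          (L := innerₗ ℝ) (f := φ) (g := f) Real.continuous_fourierChar
            (by exact continuous_inner) φ.integrable h1
        rw [flip_innerₗ] at this
        exact this
      calc _ = ∫ x, φ x • (𝓕 (h2.toLp f) : Lp ℂ 2 (volume : Measure ℝ)) x := by
              simp [hφx]
        _ = _ := by rw [← e1, e2, e3]; simp [hφx]
  have hn : ‖(𝓕 (h2.toLp f) : Lp ℂ 2 (volume : Measure ℝ))‖ₑ = ‖h2.toLp f‖ₑ := by
    rw [← ofReal_norm, ← ofReal_norm, Lp.norm_fourier_eq]
  rw [Lp.enorm_def, Lp.enorm_def, eLpNorm_congr_ae hae, eLpNorm_congr_ae h2.coeFn_toLp] at hn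
  rw [eLpNorm_eq_lintegral_rpow_enorm_toReal (by norm_num) (by norm_num),
    eLpNorm_eq_lintegral_rpow_enorm_toReal (by norm_num) (by norm_num)] at hn
  have := ENNReal.rpow_left_injective (x := 1 / (2 : ENNReal).toReal) (by norm_num) hn
  simpa [ENNReal.ofReal_pow] using this

/-- The plain Laplace transform. -/
def lapG (b : ℝ) (h : ℝ → ℂ) (w : ℂ) : ℂ :=
  ∫ t in Ioo (0:ℝ) b, Complex.exp (-w * (t : ℂ)) * h t

lemma h_integrable (b : ℝ) (h : ℝ → ℂ) (hmeas : Measurable h)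
    (hL2 : ∫⁻ t in Ioo (0:ℝ) b, ENNReal.ofReal (‖h t‖ ^ 2 / t) < ⊤) :
    IntegrableOn (fun t => ‖h t‖ ^ 2) (Ioo 0 b) ∧ IntegrableOn h (Ioo 0 b) := by
  have h0 : IntegrableOn (fun t => ‖h t‖ ^ 2 / t) (Ioo 0 b) := by
    refine ⟨((hmeas.norm.pow_const 2).div measurable_id).aestronglyMeasurable, ?_⟩
    rw [hasFiniteIntegral_iff_ofReal]
    · exact hL2
    · filter_upwards [ae_restrict_mem measurableSet_Ioo] with t ht
      have := ht.1
      simp only [Pi.zero_apply]; positivity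
  have h1 : IntegrableOn (fun t => ‖h t‖ ^ 2) (Ioo 0 b) := by
    refine Integrable.mono' (h0.const_mul b) (by fun_prop) ?_
    filter_upwards [ae_restrict_mem measurableSet_Ioo] with t ht
    have := ht.1
    rw [Real.norm_of_nonneg (by positivity), mul_div_assoc', le_div_iff₀ this, mul_comm]
    exact mul_le_mul_of_nonneg_right ht.2.le (by positivity)
  refine ⟨h1, ?_⟩
  have hc : IntegrableOn (fun _ : ℝ => (1:ℝ)) (Ioo 0 b) := by simp
  refine Integrable.mono' (hc.add h1) (by fun_prop) ?_
  filter_upwards with t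
  simp only [Pi.add_apply]
  nlinarith [sq_nonneg (‖h t‖ - 1), norm_nonneg (h t)]

lemma lapG_differentiable (b : ℝ) (h : ℝ → ℂ) (hmeas : Measurable h)
    (hi : IntegrableOn h (Ioo 0 b)) : Differentiable ℂ (lapG b h) := by
  intro w₀
  have hb1 : ∀ w : ℂ, ∀ t ∈ Ioo (0:ℝ) b, ‖w‖ ≤ ‖w₀‖ + 1 →
      ‖Complex.exp (-w * (t : ℂ))‖ ≤ Real.exp ((‖w₀‖ + 1) * b) := by
    intro w t ht hw
    rw [Complex.norm_exp, Real.exp_le_exp]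
    have e : (-w * (t:ℂ)).re = -w.re * t := by simp
    rw [e]
    have h1 : -w.re ≤ ‖w₀‖ + 1 := (neg_le_abs _).trans ((Complex.abs_re_le_norm w).trans hw)
    have := norm_nonneg w₀
    calc -w.re * t ≤ (‖w₀‖ + 1) * t := mul_le_mul_of_nonneg_right h1 ht.1.le
      _ ≤ _ := mul_le_mul_of_nonneg_left ht.2.le (by positivity)
  have hd := hasDerivAt_integral_of_dominated_loc_of_deriv_le (𝕜 := ℂ)
    (μ := volume.restrict (Ioo (0:ℝ) b))
    (F := fun w t => Complex.exp (-w * (t : ℂ)) * h t)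
    (F' := fun w t => Complex.exp (-w * (t : ℂ)) * (-1 * (t:ℂ)) * h t)
    (bound := fun t => Real.exp ((‖w₀‖ + 1) * b) * b * ‖h t‖)
    (x₀ := w₀) (Metric.ball_mem_nhds w₀ one_pos)
    (Filter.Eventually.of_forall fun w => by fun_prop)
    (by
      refine Integrable.mono' (hi.norm.const_mul (Real.exp ((‖w₀‖ + 1) * b))) (by fun_prop) ?_
      filter_upwards [ae_restrict_mem measurableSet_Ioo] with t ht
      rw [norm_mul]
      exact mul_le_mul_of_nonneg_right (hb1 w₀ t ht (by linarith)) (norm_nonneg _))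
    (by fun_prop)
    (by
      filter_upwards [ae_restrict_mem measurableSet_Ioo] with t ht w hw
      have hw' : ‖w‖ ≤ ‖w₀‖ + 1 := by
        rw [mem_ball_iff_norm] at hw
        have := norm_le_norm_add_norm_sub' w w₀
        linarith
      rw [norm_mul, norm_mul]
      have : ‖(-1 * (t:ℂ))‖ ≤ b := by
        simp only [neg_mul, one_mul, norm_neg, Complex.norm_real, Real.norm_eq_abs]
        rw [abs_of_pos ht.1]; exact ht.2.le
      gcongr
      exact hb1 w t ht hw')
    (by exact hi.norm.const_mul _)
    (by
      filter_upwards with t w _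
      exact (((hasDerivAt_id w).neg.mul_const (t:ℂ)).cexp).mul_const (h t))
  exact hd.2.differentiableAt

lemma lapG_line (b : ℝ) (h : ℝ → ℂ) (hmeas : Measurable h)
    (hi : IntegrableOn h (Ioo 0 b)) (hi2 : IntegrableOn (fun t => ‖h t‖ ^ 2) (Ioo 0 b))
    (x : ℝ) (hx : 0 < x) :
    ∫⁻ y : ℝ, ENNReal.ofReal (‖lapG b h ⟨x, y⟩‖ ^ 2) =
      ENNReal.ofReal (2 * Real.pi) *
        ∫⁻ t in Ioo (0:ℝ) b, ENNReal.ofReal (Real.exp (-2 * x * t) * ‖h t‖ ^ 2) := by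
  set f : ℝ → ℂ := (Ioo (0:ℝ) b).indicator fun t => Complex.exp (-x * t) * h t with hf
  have hm : Measurable fun t : ℝ => Complex.exp (-x * t) * h t := by fun_prop
  have hnorm : ∀ t : ℝ, ‖Complex.exp (-x * t)‖ = Real.exp (-x * t) := by
    intro t; rw [Complex.norm_exp]; simp
  have hle : ∀ t ∈ Ioo (0:ℝ) b, ‖Complex.exp (-x * t) * h t‖ ≤ ‖h t‖ := by
    intro t ht
    rw [norm_mul, hnorm]
    have : Real.exp (-x * t) ≤ 1 := Real.exp_le_one_iff.2 (by nlinarith [ht.1])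
    exact mul_le_of_le_one_left (norm_nonneg _) this
  have h1 : Integrable f := by
    rw [hf, integrable_indicator_iff measurableSet_Ioo]
    refine Integrable.mono' hi.norm (by fun_prop) ?_
    filter_upwards [ae_restrict_mem measurableSet_Ioo] with t ht using hle t ht
  have h2 : MemLp f 2 := by
    rw [hf, memLp_indicator_iff_restrict measurableSet_Ioo,
      memLp_two_iff_integrable_sq_norm (by fun_prop)]
    refine Integrable.mono' hi2 (by fun_prop) ?_
    filter_upwards [ae_restrict_mem measurableSet_Ioo] with t ht
    rw [Real.norm_of_nonneg (by positivity)]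
    exact pow_le_pow_left₀ (norm_nonneg _) (hle t ht) 2
  have hF : ∀ ξ : ℝ, 𝓕 f ξ = lapG b h ⟨x, 2 * Real.pi * ξ⟩ := by
    intro ξ
    rw [Real.fourier_real_eq_integral_exp_smul, lapG, ← integral_indicator measurableSet_Ioo]
    congr 1
    ext t
    by_cases ht : t ∈ Ioo (0:ℝ) b
    · simp only [hf, indicator_of_mem ht, smul_eq_mul]
      rw [← mul_assoc, ← Complex.exp_add]
      congr 2
      rw [Complex.mk_eq_add_mul_I]; push_cast; ring
    · simp [hf, indicator_of_notMem ht]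
  have hP := plancherel_aux f h1 h2
  have hR : ∫⁻ t : ℝ, ENNReal.ofReal (‖f t‖ ^ 2) =
      ∫⁻ t in Ioo (0:ℝ) b, ENNReal.ofReal (Real.exp (-2 * x * t) * ‖h t‖ ^ 2) := by
    rw [← lintegral_indicator measurableSet_Ioo]
    congr 1
    ext t
    by_cases ht : t ∈ Ioo (0:ℝ) b
    · simp only [hf, indicator_of_mem ht]
      rw [norm_mul, hnorm, mul_pow, ← Real.exp_nat_mul]
      congr 3; push_cast; ring_nf
    · simp [hf, indicator_of_notMem ht]
  have hdiff := (lapG_differentiable b h hmeas hi).continuous.measurable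
  rw [← hR, ← hP]
  have hpi : (2 * Real.pi) ≠ 0 := by positivity
  conv_lhs => rw [← Real.smul_map_volume_mul_left hpi]
  have hmk : Measurable fun y : ℝ => (⟨x, y⟩ : ℂ) := by
    have : (fun y : ℝ => (⟨x, y⟩ : ℂ)) = fun y : ℝ => (x:ℂ) + y * Complex.I := by
      ext y; rw [Complex.mk_eq_add_mul_I]
    rw [this]; fun_prop
  have hmm : Measurable fun y : ℝ => ENNReal.ofReal (‖lapG b h ⟨x, y⟩‖ ^ 2) :=
    (((hdiff.comp hmk).norm.pow_const 2).ennreal_ofReal)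
  rw [lintegral_smul_measure, lintegral_map hmm
    (by fun_prop), abs_of_pos (by positivity)]
  simp only [hF, smul_eq_mul]

lemma lapG_half (b : ℝ) (h : ℝ → ℂ) (hmeas : Measurable h)
    (hL2 : ∫⁻ t in Ioo (0:ℝ) b, ENNReal.ofReal (‖h t‖ ^ 2 / t) < ⊤) :
    ∫⁻ w in {w : ℂ | 0 < w.re}, ENNReal.ofReal (‖lapG b h w‖ ^ 2) < ⊤ := by
  obtain ⟨hi2, hi⟩ := h_integrable b h hmeas hL2
  have hG := (lapG_differentiable b h hmeas hi).continuous.measurable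
  have hS : MeasurableSet {w : ℂ | 0 < w.re} :=
    measurableSet_lt measurable_const Complex.measurable_re
  have hg : Measurable ({w : ℂ | 0 < w.re}.indicator
      fun w => ENNReal.ofReal (‖lapG b h w‖ ^ 2)) :=
    ((hG.norm.pow_const 2).ennreal_ofReal).indicator hS
  have e1 : ∫⁻ w in {w : ℂ | 0 < w.re}, ENNReal.ofReal (‖lapG b h w‖ ^ 2) =
      ∫⁻ x in Ioi (0:ℝ), ∫⁻ y : ℝ, ENNReal.ofReal (‖lapG b h ⟨x, y⟩‖ ^ 2) := by
    rw [← lintegral_indicator hS, ← lintegral_indicator measurableSet_Ioi,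
      ← (Complex.volume_preserving_equiv_real_prod.symm).lintegral_comp hg,
      Measure.volume_eq_prod, lintegral_prod]
    · congr 1
      ext x
      by_cases hx : 0 < x
      · simp [indicator, hx, Complex.measurableEquivRealProd]
        rfl
      · simp [indicator, hx, Complex.measurableEquivRealProd]
    · exact (hg.comp (MeasurableEquiv.measurable _)).aemeasurable
  rw [e1, setLIntegral_congr_fun measurableSet_Ioi
    (fun x hx => lapG_line b h hmeas hi hi2 x hx), lintegral_const_mul' _ _ ENNReal.ofReal_ne_top]
  refine ENNReal.mul_lt_top ENNReal.ofReal_lt_top ?_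
  rw [lintegral_lintegral_swap (by fun_prop)]
  have e2 : ∀ t ∈ Ioo (0:ℝ) b, ∫⁻ x in Ioi (0:ℝ),
      ENNReal.ofReal (Real.exp (-2 * x * t) * ‖h t‖ ^ 2) ≤ ENNReal.ofReal (‖h t‖ ^ 2 / t) := by
    intro t ht
    have ht0 := ht.1
    have e3 : ∀ x : ℝ, Real.exp (-2 * x * t) * ‖h t‖ ^ 2 =
      Real.exp ((-2 * t) * x) * ‖h t‖ ^ 2 := by intro x; congr 2; ring
    simp only [e3]
    rw [← ofReal_integral_eq_lintegral_ofReal]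
    · apply ENNReal.ofReal_le_ofReal
      rw [integral_mul_const, integral_exp_mul_Ioi (by linarith)]
      have : -Real.exp (-2 * t * 0) / (-2 * t) * ‖h t‖ ^ 2 = (‖h t‖ ^ 2 / t) / 2 := by
        simp; field_simp
      rw [this]
      have : 0 ≤ ‖h t‖ ^ 2 / t := by positivity
      linarith
    · exact (integrableOn_exp_mul_Ioi (by linarith) 0).mul_const _
    · filter_upwards with x
      simp only [Pi.zero_apply]; positivity
  exact (setLIntegral_mono' measurableSet_Ioo e2).trans_lt hL2

lemma laplace_eq (b : ℝ) (h : ℝ → ℂ) (z : ℂ) : laplaceComplement b h z =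
    2 * z / ((Real.sqrt Real.pi : ℝ) : ℂ) * lapG b h (z ^ 2) := rfl

end helpers

/-- For `h ∈ L²((0,b), dt/t)`, the function `F(z) = (2z/√π) ∫₀^b e^{−z²t} h(t) dt`
is entire and its restriction to `Δ` lies in the Bergman space `A²(Δ)`. -/
theorem laplaceComplement_entire_and_bergman
    (b : ℝ) (hb : 0 < b) (h : ℝ → ℂ) (hmeas : Measurable h)
    (hL2 : ∫⁻ t in Ioo (0:ℝ) b, ENNReal.ofReal (‖h t‖ ^ 2 / t) < ⊤) :
    Differentiable ℂ (laplaceComplement b h) ∧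
    ∫⁻ z in SectorDelta, ENNReal.ofReal (‖laplaceComplement b h z‖ ^ 2) < ⊤ := by
  obtain ⟨hi2, hi⟩ := h_integrable b h hmeas hL2
  have hG := lapG_differentiable b h hmeas hi
  constructor
  · have : laplaceComplement b h = fun z =>
      2 * z / ((Real.sqrt Real.pi : ℝ) : ℂ) * lapG b h (z ^ 2) := rfl
    rw [this]
    fun_prop
  have hS : MeasurableSet SectorDelta :=
    (measurableSet_lt measurable_const Complex.measurable_re).inter
      (measurableSet_lt (by fun_prop) Complex.measurable_re)
  have hinj : InjOn (fun z : ℂ => z ^ 2) SectorDelta := by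
    intro z hz w hw hzw
    rcases sq_eq_sq_iff_eq_or_eq_neg.1 hzw with e | e
    · exact e
    · have h1 := hz.1
      have h2 := hw.1
      rw [e, Complex.neg_re] at h1
      linarith
  have himg : (fun z : ℂ => z ^ 2) '' SectorDelta ⊆ {w : ℂ | 0 < w.re} := by
    rintro _ ⟨z, hz, rfl⟩
    have h1 := sq_lt_sq' (by linarith [abs_nonneg z.im, hz.2, hz.1]) hz.2
    rw [sq_abs] at h1
    simp only [mem_ofPred_eq, pow_two, Complex.mul_re]
    nlinarith
  have hder : ∀ z ∈ SectorDelta, HasFDerivWithinAt (fun z : ℂ => z ^ 2)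
      ((ContinuousLinearMap.toSpanSingleton ℂ (2 * z)).restrictScalars ℝ) SectorDelta z := by
    intro z _
    have := (hasDerivAt_pow 2 z).hasFDerivAt.restrictScalars ℝ
    simpa using this.hasFDerivWithinAt
  have hdet : ∀ z : ℂ, ((ContinuousLinearMap.toSpanSingleton ℂ (2 * z)).restrictScalars ℝ).det
      = 4 * ‖z‖ ^ 2 := by
    intro z
    simp [ContinuousLinearMap.det, LinearMap.det_restrictScalars,
      Algebra.norm_complex_eq, Complex.normSq_eq_norm_sq]
    ring
  have key := lintegral_image_eq_lintegral_abs_det_fderiv_mul volume hS hder hinj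
    (fun w => ENNReal.ofReal (‖lapG b h w‖ ^ 2))
  have hle : ∫⁻ z in SectorDelta, ENNReal.ofReal (‖laplaceComplement b h z‖ ^ 2) =
      ENNReal.ofReal (1 / Real.pi) *
      ∫⁻ w in (fun z : ℂ => z ^ 2) '' SectorDelta, ENNReal.ofReal (‖lapG b h w‖ ^ 2) := by
    rw [key, ← lintegral_const_mul' _ _ (by simp)]
    congr 1
    ext z
    have hpi := Real.pi_pos
    rw [hdet, abs_of_nonneg (by positivity), ← ENNReal.ofReal_mul (by positivity),
      ← ENNReal.ofReal_mul (by positivity), laplace_eq]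
    congr 1
    simp only [norm_mul, norm_div, Complex.norm_real, mul_pow, div_pow, Real.norm_eq_abs, sq_abs,
      Real.sq_sqrt hpi.le, Complex.norm_ofNat]
    field_simp
    ring
  rw [hle]
  exact ENNReal.mul_lt_top (by simp)
    ((lintegral_mono_set himg).trans_lt (lapG_half b h hmeas hL2))

end
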